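/- arXiv:2210.16835 — 3 statements merged into one kernel-verified Lean document; each statement's English description precedes it below -/
import Mathlib

section
/- Let n ≥ 1 and let μ_0, …, μ_{n−1} be Borel probability measures on ℝ, each with finite second moment, with σ_k the standard deviation of μ_k. Let μ = (1/n) ∑_{k=0}^{n−1} μ_k denote the uniform mixture. Then ( (1/n) ∑_{k=0}^{n−1} σ_k )² ≤ Var(μ), where Var(μ) is the variance of the identity function under μ. Consequently, for any m > 0, the variance (1/m)((1/n)∑_k σ_k)² of the stratified estimator with the optimal allocation m_k* = m σ_k / ∑_j σ_j is at most the variance Var(μ)/m of the permutation sampling estimator based on m independent samples from μ. -/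
open MeasureTheory ProbabilityTheory
open scoped ENNReal

/-- Law of total variance, as an inequality: the within-component part of the variance of a
uniformly weighted mixture is at most its total variance. -/
theorem mul_sum_variance_le_variance_smul_sum {ι Ω : Type*} [Fintype ι] [MeasurableSpace Ω]
    (μ : ι → Measure Ω) [∀ k, IsProbabilityMeasure (μ k)] {X : Ω → ℝ} (hX : Measurable X)
    (hL2 : ∀ k, MemLp X 2 (μ k)) (c : ℝ≥0∞) :
    c.toReal * ∑ k, variance X (μ k) ≤ variance X (c • ∑ k, μ k) := by
  rw [variance_eq_integral hX.aemeasurable, integral_smul_measure, smul_eq_mul]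
  generalize ∫ x, X x ∂(c • ∑ k, μ k) = a
  have hsub (k : ι) : MemLp (fun x => X x - a) 2 (μ k) := (hL2 k).sub (memLp_const a)
  rw [integral_finsetSum_measure fun k _ => (hsub k).integrable_sq]
  gcongr with k
  rw [← variance_sub_const hX.aestronglyMeasurable a]
  exact variance_le_expectation_sq (hsub k).aestronglyMeasurable

/-- Variance comparison (Theorem 1, comparison part): for probability measures
`μ_k` on `ℝ` with finite second moments and standard deviations `σ_k`, with
`μ` the uniform mixture, `((1/n) ∑ σ_k)² ≤ Var(μ)`; consequently, for any
`m > 0`, the variance `(1/m)((1/n) ∑ σ_k)²` of the optimally allocated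
stratified estimator is at most the variance `Var(μ)/m` of the permutation
sampling estimator based on `m` independent samples. -/
theorem stmt_4
    (n : ℕ) (hn : 1 ≤ n) (μ : Fin n → Measure ℝ)
    (hprob : ∀ k, IsProbabilityMeasure (μ k))
    (hL2 : ∀ k, Integrable (fun x => x ^ 2) (μ k)) :
    ((1 / (n : ℝ)) * ∑ k, Real.sqrt (variance (fun x => x) (μ k))) ^ 2 ≤
        variance (fun x => x) (((n : ℝ≥0∞))⁻¹ • ∑ k, μ k) ∧
      ∀ m : ℝ, 0 < m →
        (1 / m) * ((1 / (n : ℝ)) * ∑ k, Real.sqrt (variance (fun x => x) (μ k))) ^ 2 ≤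
          variance (fun x => x) (((n : ℝ≥0∞))⁻¹ • ∑ k, μ k) / m := by
  have hvar : ((1 / (n : ℝ)) * ∑ k, Real.sqrt (variance (fun x => x) (μ k))) ^ 2 ≤
      variance (fun x => x) (((n : ℝ≥0∞))⁻¹ • ∑ k, μ k) := by
    have hn' : (0 : ℝ) < n := by exact_mod_cast hn
    calc ((1 / (n : ℝ)) * ∑ k, Real.sqrt (variance (fun x => x) (μ k))) ^ 2
        = (1 / (n : ℝ)) ^ 2 * (∑ k, Real.sqrt (variance (fun x => x) (μ k))) ^ 2 := mul_pow _ _ _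
      _ ≤ (1 / (n : ℝ)) ^ 2 * (n * ∑ k, Real.sqrt (variance (fun x => x) (μ k)) ^ 2) := by
          gcongr
          simpa using sq_sum_le_card_mul_sum_sq (s := Finset.univ)
            (f := fun k => Real.sqrt (variance (fun x => x) (μ k)))
      _ = ((n : ℝ≥0∞)⁻¹).toReal * ∑ k, variance (fun x => x) (μ k) := by
          simp only [Real.sq_sqrt (variance_nonneg _ _), ENNReal.toReal_inv, ENNReal.toReal_natCast]
          field_simp
      _ ≤ variance (fun x => x) (((n : ℝ≥0∞))⁻¹ • ∑ k, μ k) :=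
          mul_sum_variance_le_variance_smul_sum μ measurable_id
            (fun k => (memLp_two_iff_integrable_sq measurable_id.aestronglyMeasurable).2 (hL2 k)) _
  refine ⟨hvar, fun m hm => ?_⟩
  rw [one_div_mul_eq_div]
  gcongr
end

section
/- Let n ≥ 1, let f(0), …, f(n−1) be strictly positive real numbers, let d ≥ 0, let m > 0, and let σ_0, …, σ_{n−1} be nonnegative reals with σ_k ≤ d·f(k)/2 for every k. With the allocation m̃_k = m · f(k) / ∑_{j=0}^{n−1} f(j), one has (1/n²) ∑_{k=0}^{n−1} σ_k² / m̃_k ≤ d² (∑_{j=0}^{n−1} f(j))² / (4 m n²). -/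
/-- Theorem 2 (quantitative content): if `σ_k ≤ d·f(k)/2` for every stratum
and the budget `m` is allocated proportionally to `f`, i.e.
`m̃_k = m f(k) / ∑ f(j)`, then the stratified variance satisfies
`(1/n²) ∑ σ_k²/m̃_k ≤ d² (∑ f(j))² / (4 m n²)`. -/
theorem stmt_6
    (n : ℕ) (hn : 1 ≤ n) (f : Fin n → ℝ) (hf : ∀ k, 0 < f k)
    (d : ℝ) (hd : 0 ≤ d) (m : ℝ) (hm : 0 < m)
    (σ : Fin n → ℝ) (hσ0 : ∀ k, 0 ≤ σ k) (hσ : ∀ k, σ k ≤ d * f k / 2) :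
    (1 / (n : ℝ) ^ 2) * ∑ k, σ k ^ 2 / (m * f k / ∑ j, f j) ≤
      d ^ 2 * (∑ j, f j) ^ 2 / (4 * m * (n : ℝ) ^ 2) := by
  have hn' : (0 : ℝ) < n := by exact_mod_cast hn
  have hS : 0 < ∑ j, f j :=
    Finset.sum_pos (fun k _ => hf k) ⟨⟨0, hn⟩, Finset.mem_univ _⟩
  set S := ∑ j, f j with hSdef
  have hterm : ∀ k, σ k ^ 2 / (m * f k / S) ≤ d ^ 2 * S / (4 * m) * f k := by
    intro k
    have hk := hf k
    calc σ k ^ 2 / (m * f k / S) ≤ (d * f k / 2) ^ 2 / (m * f k / S) := by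
          gcongr
          · exact hσ0 k
          · exact hσ k
      _ = d ^ 2 * S / (4 * m) * f k := by
          field_simp
          norm_num
  calc (1 / (n : ℝ) ^ 2) * ∑ k, σ k ^ 2 / (m * f k / S)
      ≤ (1 / (n : ℝ) ^ 2) * ∑ k, d ^ 2 * S / (4 * m) * f k := by
        gcongr with k
        exact hterm k
    _ = d ^ 2 * S ^ 2 / (4 * m * (n : ℝ) ^ 2) := by
        rw [← Finset.mul_sum, ← hSdef]
        field_simp
end

section
/- Let n ≥ 1, let N = {1, …, n} be a finite set of n players, let U be a real-valued function on subsets of N, and let i, j ∈ N be two distinct players such that U(S ∪ {i}) = U(S ∪ {j}) for every subset S ⊆ N with i ∉ S and j ∉ S. Define the Shapley value of a player l as φ_l(U) = (1/n) ∑_{k=0}^{n−1} (1/C(n−1,k)) ∑_{S ⊆ N∖{l}, |S| = k} ( U(S ∪ {l}) − U(S) ). Then φ_i(U) = φ_j(U). -/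
/-- A set function that does not distinguish `i` from `j` is invariant under swapping them. -/
theorem map_swap_eq_of_insert_eq {α β : Type*} [DecidableEq α] {U : Finset α → β} {i j : α}
    (hsym : ∀ S : Finset α, i ∉ S → j ∉ S → U (insert i S) = U (insert j S)) (S : Finset α) :
    U (S.map (Equiv.swap i j).toEmbedding) = U S := by
  by_cases hi : i ∈ S <;> by_cases hj : j ∈ S
  · congr 1
    ext x
    simp only [Finset.mem_map_equiv, Equiv.symm_swap, Equiv.swap_apply_def]
    grind
  · have hS : insert i (S.erase i) = S := Finset.insert_erase hi
    have hmap : S.map (Equiv.swap i j).toEmbedding = insert j (S.erase i) := by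
      ext x
      simp only [Finset.mem_map_equiv, Equiv.symm_swap, Equiv.swap_apply_def]
      grind
    rw [hmap, ← hsym _ (by grind) (by grind), hS]
  · have hS : insert j (S.erase j) = S := Finset.insert_erase hj
    have hmap : S.map (Equiv.swap i j).toEmbedding = insert i (S.erase j) := by
      ext x
      simp only [Finset.mem_map_equiv, Equiv.symm_swap, Equiv.swap_apply_def]
      grind
    rw [hmap, hsym _ (by grind) (by grind), hS]
  · congr 1
    ext x
    simp only [Finset.mem_map_equiv, Equiv.symm_swap, Equiv.swap_apply_def]
    grind

/-- Symmetry axiom for the Shapley value: if two distinct players `i` and `j`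
satisfy `U(S ∪ {i}) = U(S ∪ {j})` for every subset `S` with `i ∉ S` and
`j ∉ S`, then they have the same Shapley value
`φ_l(U) = (1/n) ∑_{k=0}^{n−1} (1/C(n−1,k)) ∑_{S ⊆ N∖{l}, |S|=k} (U(S∪{l}) − U(S))`. -/
theorem stmt_13
    (n : ℕ) (hn : 1 ≤ n) (U : Finset (Fin n) → ℝ) (i j : Fin n) (hij : i ≠ j)
    (hsym : ∀ S : Finset (Fin n), i ∉ S → j ∉ S →
      U (insert i S) = U (insert j S)) :
    (1 / (n : ℝ)) * ∑ k ∈ Finset.range n,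
        (1 / ((n - 1).choose k : ℝ)) *
          ∑ S ∈ Finset.powersetCard k (Finset.univ.erase i),
            (U (insert i S) - U S) =
      (1 / (n : ℝ)) * ∑ k ∈ Finset.range n,
        (1 / ((n - 1).choose k : ℝ)) *
          ∑ S ∈ Finset.powersetCard k (Finset.univ.erase j),
            (U (insert j S) - U S) := by
  congr 1
  refine Finset.sum_congr rfl fun k _ => ?_
  congr 1
  refine Finset.sum_equiv (Equiv.finsetCongr (Equiv.swap i j)) (fun S => ?_) fun S _ => ?_
  · simp [Finset.mem_powersetCard, Finset.subset_erase, Finset.mem_map_equiv]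
  · have hins := map_swap_eq_of_insert_eq hsym (insert i S)
    rw [Finset.map_insert, Equiv.toEmbedding_apply, Equiv.swap_apply_left] at hins
    rw [Equiv.finsetCongr_apply, hins, map_swap_eq_of_insert_eq hsym S]
end
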